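/- Let X be a compact metric space, f : X → X a continuous map, and C a chain component of f. Then W^s(C) is the disjoint union of the sets V^s(D) over all D ∈ 𝒟(C) (every x ∈ W^s(C) belongs to V^s(D) for exactly one D ∈ 𝒟(C)), and V^s(D) is a G_δ-subset of W^s(C) for every D ∈ 𝒟(C). -/

import Mathlib

open Filter Metric Set Topology

section Defs

variable {X : Type*} [MetricSpace X]

/-- A δ-chain of `f` of length `k` (with `k ≥ 1`) within the set `C`, from `x` to `y`. -/
def ChainIn (f : X → X) (C : Set X) (δ : ℝ) (k : ℕ) (x y : X) : Prop :=
  1 ≤ k ∧ ∃ c : ℕ → X, c 0 = x ∧ c k = y ∧ (∀ i ≤ k, c i ∈ C) ∧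
    ∀ i < k, dist (f (c i)) (c (i + 1)) ≤ δ

/-- `x → y` : for every `δ > 0` there is a `δ`-chain of `f` from `x` to `y`. -/
def ChainReach (f : X → X) (x y : X) : Prop :=
  ∀ δ > 0, ∃ k, ChainIn f Set.univ δ k x y

/-- `x` is chain recurrent for `f`. -/
def ChainRecurrent (f : X → X) (x : X) : Prop := ChainReach f x x

/-- `C` is a chain component of `f`: an equivalence class of the relation `↔`
on the set of chain recurrent points. -/
def IsChainComponent (f : X → X) (C : Set X) : Prop :=
  ∃ x, ChainRecurrent f x ∧
    C = {y | ChainRecurrent f y ∧ ChainReach f x y ∧ ChainReach f y x}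

/-- The set of lengths of δ-cycles of `f` restricted to `C`. -/
def cycleLengths (f : X → X) (C : Set X) (δ : ℝ) : Set ℕ :=
  {k | ∃ x ∈ C, ChainIn f C δ k x x}

/-- The greatest common divisor of a set of natural numbers
(the greatest natural number dividing every element). -/
noncomputable def setGcd (S : Set ℕ) : ℕ := sSup {d | ∀ k ∈ S, d ∣ k}

/-- `x ∼_{C,δ} y` : there is a δ-chain of `f|_C` from `x` to `y` whose length is
divisible by `m(C,δ)`, the gcd of the lengths of all δ-cycles of `f|_C`. -/
def SimCd (f : X → X) (C : Set X) (δ : ℝ) (x y : X) : Prop :=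
  ∃ k, setGcd (cycleLengths f C δ) ∣ k ∧ ChainIn f C δ k x y

/-- `x ∼_C y` : `x ∼_{C,δ} y` for all `δ > 0`. -/
def SimC (f : X → X) (C : Set X) (x y : X) : Prop :=
  ∀ δ > 0, SimCd f C δ x y

/-- `𝒟(C,δ)` : the set of equivalence classes of `∼_{C,δ}`. -/
def DClassesd (f : X → X) (C : Set X) (δ : ℝ) : Set (Set X) :=
  {D | ∃ x ∈ C, D = {y ∈ C | SimCd f C δ x y}}

/-- `𝒟(C)` : the set of equivalence classes of `∼_C`. -/
def DClasses (f : X → X) (C : Set X) : Set (Set X) :=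
  {D | ∃ x ∈ C, D = {y ∈ C | SimC f C x y}}

/-- `W^s(C) = {x : lim_{i→∞} d(f^i(x), C) = 0}`. -/
def wStable (f : X → X) (C : Set X) : Set X :=
  {x | Tendsto (fun i => infDist (f^[i] x) C) atTop (nhds 0)}

/-- `V^s(D) = ⋂_{δ>0} {x ∈ W^s(C) : lim_{i→∞} d(f^i(x), f^i(D_δ)) = 0}`, where
`D_δ` is the unique element of `𝒟(C,δ)` containing `D`. -/
def vStable (f : X → X) (C D : Set X) : Set X :=
  {x | x ∈ wStable f C ∧ ∀ δ > 0, ∀ Dd ∈ DClassesd f C δ, D ⊆ Dd →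
    Tendsto (fun i => infDist (f^[i] x) (f^[i] '' Dd)) atTop (nhds 0)}

/-- The s-limit shadowing property. -/
def SLimitShadowing (f : X → X) : Prop :=
  ∀ ε > 0, ∃ δ > 0, ∀ x : ℕ → X,
    (∀ i, dist (f (x i)) (x (i + 1)) ≤ δ) →
    Tendsto (fun i => dist (f (x i)) (x (i + 1))) atTop (nhds 0) →
    ∃ z : X, (∀ i, dist (f^[i] z) (x i) ≤ ε) ∧
      Tendsto (fun i => dist (f^[i] z) (x i)) atTop (nhds 0)

/-- The limit shadowing property. -/
def LimitShadowing (f : X → X) : Prop :=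
  ∀ x : ℕ → X, Tendsto (fun i => dist (f (x i)) (x (i + 1))) atTop (nhds 0) →
    ∃ z : X, Tendsto (fun i => dist (f^[i] z) (x i)) atTop (nhds 0)

/-- The (plain) shadowing property. -/
def ShadowingProperty (f : X → X) : Prop :=
  ∀ ε > 0, ∃ δ > 0, ∀ x : ℕ → X, (∀ i, dist (f (x i)) (x (i + 1)) ≤ δ) →
    ∃ z : X, ∀ i, dist (f^[i] z) (x i) ≤ ε

/-- A Furstenberg family: hereditary upward and proper. -/
def FurstenbergFamily (F : Set (Set ℕ)) : Prop :=
  (∀ A B : Set ℕ, A ∈ F → A ⊆ B → B ∈ F) ∧ F.Nonempty ∧ F ≠ Set.univ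

/-- A full Furstenberg family. -/
def FullFamily (F : Set (Set ℕ)) : Prop :=
  ∀ A ∈ F, ∀ n : ℕ, {i ∈ A | n ≤ i} ∈ F

/-- A translation invariant Furstenberg family. -/
def TranslationInvariantFamily (F : Set (Set ℕ)) : Prop :=
  ∀ A ∈ F, ∀ n : ℕ, ((fun i => i + n) '' A ∈ F ∧ {i | i + n ∈ A} ∈ F)

/-- `S_f(x₁,…,xₙ; r) = {i : min_{j<k} d(fⁱ(x_j), fⁱ(x_k)) > r}`. -/
def Sset (f : X → X) {n : ℕ} (x : Fin n → X) (r : ℝ) : Set ℕ :=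
  {i | ∀ j k : Fin n, j < k → r < dist (f^[i] (x j)) (f^[i] (x k))}

/-- `T_f(x₁,…,xₙ; r) = {i : max_{j<k} d(fⁱ(x_j), fⁱ(x_k)) < r}`. -/
def Tset (f : X → X) {n : ℕ} (x : Fin n → X) (r : ℝ) : Set ℕ :=
  {i | ∀ j k : Fin n, j < k → dist (f^[i] (x j)) (f^[i] (x k)) < r}

/-- `(x₁,…,xₙ)` is an `(ℱ,𝒢)`-δ-scrambled n-tuple for `f`. -/
def Scrambled (f : X → X) (F G : Set (Set ℕ)) (δ : ℝ) {n : ℕ} (x : Fin n → X) : Prop :=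
  Sset f x δ ∈ F ∧ ∀ ε > 0, Tset f x ε ∈ G

/-- `Y` is dense `(ℱ,𝒢)`-n-δ-chaotic for `f`: the `(ℱ,𝒢)`-δ-scrambled n-tuples in `Yⁿ`
form a dense subset of `Yⁿ`. -/
def DenseChaotic (f : X → X) (F G : Set (Set ℕ)) (n : ℕ) (δ : ℝ) (Y : Set X) : Prop :=
  {x : Fin n → X | ∀ j, x j ∈ Y} ⊆
    closure {x : Fin n → X | (∀ j, x j ∈ Y) ∧ Scrambled f F G δ x}

/-- `S` is a residual subset of the subspace `T`: it contains a countable intersection of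
dense open subsets of `T`. -/
def ResidualIn {α : Type*} [TopologicalSpace α] (T S : Set α) : Prop :=
  ∃ U : ℕ → Set α, (∀ i, IsOpen (U i)) ∧ (∀ i, T ⊆ closure (U i ∩ T)) ∧
    (⋂ i, U i) ∩ T ⊆ S

/-- `Y` is generic `(ℱ,𝒢)`-n-δ-chaotic for `f`: the `(ℱ,𝒢)`-δ-scrambled n-tuples in `Yⁿ`
form a residual subset of `Yⁿ`. -/
def GenericChaotic (f : X → X) (F G : Set (Set ℕ)) (n : ℕ) (δ : ℝ) (Y : Set X) : Prop :=
  ResidualIn {x : Fin n → X | ∀ j, x j ∈ Y}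
    {x : Fin n → X | (∀ j, x j ∈ Y) ∧ Scrambled f F G δ x}

/-- A Furstenberg family `F` is compatible with `(Z, g)`. -/
def CompatibleFamily {Z : Type*} [TopologicalSpace Z] (F : Set (Set ℕ)) (g : Z → Z) : Prop :=
  ∀ U : Set Z, IsOpen U → IsGδ {z | {i | g^[i] z ∈ U} ∈ F}

end Defs

section Chains

variable {X : Type*} [MetricSpace X] {f : X → X} {C : Set X} {δ δ₁ δ₂ : ℝ} {k l : ℕ} {x y z : X}

theorem ChainIn.left_mem (h : ChainIn f C δ k x y) : x ∈ C := by
  obtain ⟨_, c, rfl, _, hc, _⟩ := h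
  exact hc 0 (Nat.zero_le _)

theorem ChainIn.right_mem (h : ChainIn f C δ k x y) : y ∈ C := by
  obtain ⟨_, c, _, rfl, hc, _⟩ := h
  exact hc k le_rfl

theorem ChainIn.mono (h : ChainIn f C δ₁ k x y) (hδ : δ₁ ≤ δ₂) : ChainIn f C δ₂ k x y := by
  obtain ⟨hk, c, h0, h1, hc, hd⟩ := h
  exact ⟨hk, c, h0, h1, hc, fun i hi => (hd i hi).trans hδ⟩

theorem ChainIn.single (hx : x ∈ C) (hy : y ∈ C) (h : dist (f x) y ≤ δ) :
    ChainIn f C δ 1 x y := by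
  refine ⟨le_rfl, fun i => if i = 0 then x else y, by simp, by simp, fun i _ => ?_, fun i hi => ?_⟩
  · dsimp only
    split_ifs <;> assumption
  · obtain rfl : i = 0 := by omega
    simpa using h

theorem ChainIn.trans (h : ChainIn f C δ k x y) (h' : ChainIn f C δ l y z) :
    ChainIn f C δ (k + l) x z := by
  obtain ⟨hk, c, h0, h1, hc, hd⟩ := h
  obtain ⟨hl, c', h0', h1', hc', hd'⟩ := h'
  refine ⟨by omega, fun i => if i ≤ k then c i else c' (i - k), by simpa using h0, ?_,
    fun i hi => ?_, fun i hi => ?_⟩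
  · have : ¬ k + l ≤ k := by omega
    simpa [this] using h1'
  · dsimp only
    split_ifs with hik
    · exact hc i hik
    · exact hc' _ (by omega)
  · dsimp only
    rcases lt_trichotomy i k with hik | rfl | hik
    · rw [if_pos hik.le, if_pos (by omega)]
      exact hd i hik
    · rw [if_pos le_rfl, if_neg (by omega), h1, ← h0', Nat.add_sub_cancel_left]
      exact hd' 0 (by omega)
    · rw [if_neg (by omega), if_neg (by omega), show i + 1 - k = i - k + 1 by omega]
      exact hd' _ (by omega)

theorem ChainIn.perturb_right (h : ChainIn f C δ₁ k x y) (hz : z ∈ C) (hd : dist y z ≤ δ₂) :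
    ChainIn f C (δ₁ + δ₂) k x z := by
  obtain ⟨hk, c, rfl, rfl, hc, hcd⟩ := h
  have hδ₂ : 0 ≤ δ₂ := dist_nonneg.trans hd
  refine ⟨hk, Function.update c k z, ?_, by simp, fun i hi => ?_, fun i hi => ?_⟩
  · rw [Function.update_of_ne (by omega)]
  · rcases eq_or_ne i k with rfl | hik
    · simpa using hz
    · rw [Function.update_of_ne hik]
      exact hc i hi
  · rw [Function.update_of_ne hi.ne]
    rcases eq_or_ne (i + 1) k with hik | hik
    · subst hik
      rw [Function.update_self]
      exact (dist_triangle _ _ _).trans (add_le_add (hcd i hi) hd)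
    · rw [Function.update_of_ne hik]
      linarith [hcd i hi]

theorem ChainIn.perturb_left (h : ChainIn f C δ₁ k x y) (hz : z ∈ C)
    (hd : dist (f z) (f x) ≤ δ₂) : ChainIn f C (δ₁ + δ₂) k z y := by
  obtain ⟨hk, c, rfl, rfl, hc, hcd⟩ := h
  have hδ₂ : 0 ≤ δ₂ := dist_nonneg.trans hd
  refine ⟨hk, Function.update c 0 z, by simp, ?_, fun i hi => ?_, fun i hi => ?_⟩
  · rw [Function.update_of_ne (by omega)]
  · rcases eq_or_ne i 0 with rfl | hi0
    · simpa using hz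
    · rw [Function.update_of_ne hi0]
      exact hc i hi
  · rw [Function.update_of_ne (Nat.succ_ne_zero i)]
    rcases eq_or_ne i 0 with rfl | hi0
    · rw [Function.update_self]
      linarith [hcd 0 hi, dist_triangle (f z) (f (c 0)) (c (0 + 1))]
    · rw [Function.update_of_ne hi0]
      linarith [hcd i hi]

theorem ChainReach.trans (h : ChainReach f x y) (h' : ChainReach f y z) : ChainReach f x z := by
  intro δ hδ
  obtain ⟨k, hk⟩ := h δ hδ
  obtain ⟨l, hl⟩ := h' δ hδ
  exact ⟨k + l, hk.trans hl⟩

/-- Chains of arbitrarily small error ending arbitrarily close to `y` can be made to end at `y`. -/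
theorem ChainReach.of_forall_right
    (h : ∀ ε > 0, ∃ w k, dist w y ≤ ε ∧ ChainIn f univ ε k x w) : ChainReach f x y := by
  intro δ hδ
  obtain ⟨w, k, hw, hk⟩ := h (δ / 2) (by linarith)
  exact ⟨k, (hk.perturb_right (mem_univ y) hw).mono (by linarith)⟩

/-- Chains of arbitrarily small error starting arbitrarily close to `x` can be made to start
at `x`. -/
theorem ChainReach.of_forall_left (hf : Continuous f)
    (h : ∀ ε > 0, ∃ w k, dist w x ≤ ε ∧ ChainIn f univ ε k w y) : ChainReach f x y := by
  intro δ hδ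
  obtain ⟨η, hη, hfη⟩ := Metric.continuous_iff.1 hf x (δ / 2) (by linarith)
  obtain ⟨w, k, hw, hk⟩ := h (min (δ / 2) (η / 2)) (lt_min (by linarith) (by linarith))
  have hwη : dist w x < η := by linarith [hw.trans (min_le_right _ _)]
  refine ⟨k, (hk.perturb_left (mem_univ x) (δ₂ := δ / 2) ?_).mono ?_⟩
  · rw [dist_comm]
    exact (hfη w hwη).le
  · linarith [min_le_left (δ / 2) (η / 2)]

theorem IsChainComponent.nonempty (hC : IsChainComponent f C) : C.Nonempty := by
  obtain ⟨x, hx, rfl⟩ := hC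
  exact ⟨x, hx, hx, hx⟩

theorem IsChainComponent.reach (hC : IsChainComponent f C) (hx : x ∈ C) (hy : y ∈ C) :
    ChainReach f x y := by
  obtain ⟨p, _, rfl⟩ := hC
  exact hx.2.2.trans hy.2.1

theorem IsChainComponent.mem_of_reach (hC : IsChainComponent f C) (hx : x ∈ C) (hz : z ∈ C)
    (hxy : ChainReach f x y) (hyz : ChainReach f y z) : y ∈ C := by
  obtain ⟨p, _, rfl⟩ := hC
  have h1 := hx.2.1.trans hxy
  have h2 := hyz.trans hz.2.2
  exact ⟨h2.trans h1, h1, h2⟩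

theorem IsChainComponent.isClosed (hf : Continuous f) (hC : IsChainComponent f C) :
    IsClosed C := by
  obtain ⟨p, hp⟩ := hC.nonempty
  refine isClosed_of_closure_subset fun y hy => ?_
  rw [Metric.mem_closure_iff] at hy
  refine hC.mem_of_reach hp hp (.of_forall_right fun ε hε => ?_)
    (.of_forall_left hf fun ε hε => ?_)
  · obtain ⟨w, hw, hd⟩ := hy ε hε
    obtain ⟨k, hk⟩ := hC.reach hp hw ε hε
    exact ⟨w, k, by rw [dist_comm]; exact hd.le, hk⟩
  · obtain ⟨w, hw, hd⟩ := hy ε hε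
    obtain ⟨k, hk⟩ := hC.reach hw hp ε hε
    exact ⟨w, k, by rw [dist_comm]; exact hd.le, hk⟩

/-- Points on chains of small error between two points of a chain component are close to the
component. -/
theorem IsChainComponent.infDist_lt_of_chain [CompactSpace X] (hf : Continuous f)
    (hC : IsChainComponent f C) (hx : x ∈ C) (hz : z ∈ C) {η : ℝ} (hη : 0 < η) :
    ∃ ε > 0, ∀ w k l, ChainIn f univ ε k x w → ChainIn f univ ε l w z → infDist w C < η := by
  by_contra! hcon
  choose w k l hk hl hw using fun n : ℕ => hcon (1 / ((n : ℝ) + 1)) Nat.one_div_pos_of_nat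
  obtain ⟨a, -, ψ, hψ, ha⟩ := isCompact_univ.tendsto_subseq fun n => mem_univ (w n)
  have hsmall : ∀ ε > 0, ∃ n, dist (w n) a ≤ ε ∧ 1 / ((n : ℝ) + 1) ≤ ε := by
    intro ε hε
    have h1 : ∀ᶠ n in atTop, dist (w (ψ n)) a < ε := Metric.tendsto_nhds.1 ha ε hε
    have h2 : ∀ᶠ n in atTop, 1 / ((ψ n : ℝ) + 1) < ε :=
      (tendsto_one_div_add_atTop_nhds_zero_nat.comp hψ.tendsto_atTop).eventually_lt_const hε
    obtain ⟨n, hn1, hn2⟩ := (h1.and h2).exists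
    exact ⟨ψ n, hn1.le, hn2.le⟩
  have haC : a ∈ C := by
    refine hC.mem_of_reach hx hz (.of_forall_right fun ε hε => ?_)
      (.of_forall_left hf fun ε hε => ?_)
    · obtain ⟨n, hn, hnε⟩ := hsmall ε hε
      exact ⟨w n, k n, hn, (hk n).mono hnε⟩
    · obtain ⟨n, hn, hnε⟩ := hsmall ε hε
      exact ⟨w n, l n, hn, (hl n).mono hnε⟩
  obtain ⟨n, hn, -⟩ := hsmall (η / 2) (by linarith)
  linarith [hw n, infDist_le_dist_of_mem (x := w n) haC]

/-- `f` restricted to `C` is chain transitive. -/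
def ChainTransitiveOn (f : X → X) (C : Set X) : Prop :=
  ∀ δ > 0, ∀ x ∈ C, ∀ y ∈ C, ∃ k, ChainIn f C δ k x y

theorem IsChainComponent.chainTransitiveOn [CompactSpace X] (hf : Continuous f)
    (hC : IsChainComponent f C) : ChainTransitiveOn f C := by
  intro δ hδ x hx y hy
  obtain ⟨η, hη, hfη⟩ := Metric.uniformContinuous_iff.1
    (CompactSpace.uniformContinuous_of_continuous hf) (δ / 3) (by linarith)
  obtain ⟨ε, hε, hnear⟩ := hC.infDist_lt_of_chain hf hx hy (lt_min hη (by linarith : 0 < δ / 3))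
  obtain ⟨k, hk, c, rfl, rfl, -, hd⟩ := hC.reach hx hy (min ε (δ / 3)) (lt_min hε (by linarith))
  have hclose : ∀ i ≤ k, infDist (c i) C < min η (δ / 3) := by
    intro i hi
    have hpos : 0 < min η (δ / 3) := lt_min hη (by linarith)
    rcases eq_or_ne i 0 with rfl | hi0
    · rwa [infDist_zero_of_mem hx]
    rcases eq_or_ne i k with rfl | hik
    · rwa [infDist_zero_of_mem hy]
    refine hnear (c i) i (k - i) ⟨by omega, c, rfl, rfl, fun _ _ => mem_univ _, fun j hj =>
      (hd j (by omega)).trans (min_le_left _ _)⟩ ⟨by omega, fun j => c (i + j), rfl, ?_,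
      fun _ _ => mem_univ _, fun j hj => (hd (i + j) (by omega)).trans (min_le_left _ _)⟩
    dsimp only
    rw [show i + (k - i) = k by omega]
  choose g hgC hg using (hC.isClosed hf).isCompact.exists_infDist_eq_dist hC.nonempty
  have hfix : ∀ z ∈ C, g z = z := fun z hz => by
    have := hg z
    rw [infDist_zero_of_mem hz] at this
    exact (dist_eq_zero.1 this.symm).symm
  refine ⟨k, hk, fun i => g (c i), hfix _ hx, hfix _ hy, fun i _ => hgC _, fun i hi => ?_⟩
  have h1 : dist (f (g (c i))) (f (c i)) < δ / 3 := by
    refine hfη ?_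
    rw [dist_comm, ← hg]
    exact (hclose i hi.le).trans_le (min_le_left _ _)
  have h2 : dist (f (c i)) (c (i + 1)) ≤ δ / 3 := (hd i hi).trans (min_le_right _ _)
  have h3 : dist (c (i + 1)) (g (c (i + 1))) < δ / 3 := by
    rw [← hg]
    exact (hclose (i + 1) hi).trans_le (min_le_right _ _)
  linarith [dist_triangle4 (f (g (c i))) (f (c i)) (c (i + 1)) (g (c (i + 1)))]

theorem ChainTransitiveOn.mapsTo (hT : ChainTransitiveOn f C) (hC : IsClosed C) :
    MapsTo f C C := by
  intro x hx
  refine hC.closure_subset (Metric.mem_closure_iff.2 fun ε hε => ?_)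
  obtain ⟨k, hk, c, rfl, -, hc, hd⟩ := hT (ε / 2) (by linarith) x hx x hx
  exact ⟨c (0 + 1), hc _ hk, (hd 0 hk).trans_lt (by linarith)⟩

theorem ChainTransitiveOn.surjOn [CompactSpace X] (hf : Continuous f)
    (hT : ChainTransitiveOn f C) (hC : IsClosed C) : SurjOn f C C := by
  intro y hy
  refine (hC.isCompact.image hf).isClosed.closure_subset
    (Metric.mem_closure_iff.2 fun ε hε => ?_)
  obtain ⟨k, hk, c, -, rfl, hc, hd⟩ := hT (ε / 2) (by linarith) y hy y hy
  refine ⟨f (c (k - 1)), mem_image_of_mem _ (hc _ (by omega)), ?_⟩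
  have := hd (k - 1) (by omega)
  rw [Nat.sub_add_cancel hk] at this
  rw [dist_comm]
  linarith

theorem setGcd_dvd {S : Set ℕ} (hS : ∃ k ∈ S, k ≠ 0) {k : ℕ} (hk : k ∈ S) : setGcd S ∣ k := by
  obtain ⟨l, hl, hl0⟩ := hS
  have hmem : setGcd S ∈ {d | ∀ k ∈ S, d ∣ k} :=
    Nat.sSup_mem ⟨1, fun _ _ => one_dvd _⟩
      ⟨l, fun d hd => Nat.le_of_dvd (Nat.pos_of_ne_zero hl0) (hd l hl)⟩
  exact hmem k hk

theorem dvd_setGcd {S : Set ℕ} (hS : ∃ k ∈ S, k ≠ 0) {d : ℕ} (hd : ∀ k ∈ S, d ∣ k) :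
    d ∣ setGcd S := by
  obtain ⟨l, hl, hl0⟩ := id hS
  have hpos : setGcd S ≠ 0 := fun h => hl0 (by simpa [h] using setGcd_dvd hS hl)
  have hlcm : Nat.lcm d (setGcd S) ≤ setGcd S :=
    le_csSup ⟨l, fun d hd => Nat.le_of_dvd (Nat.pos_of_ne_zero hl0) (hd l hl)⟩
      fun k hk => Nat.lcm_dvd (hd k hk) (setGcd_dvd hS hk)
  have heq : Nat.lcm d (setGcd S) = setGcd S :=
    hlcm.antisymm (Nat.le_of_dvd (Nat.pos_of_ne_zero fun h => by
      rcases Nat.lcm_eq_zero_iff.1 h with rfl | h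
      · exact hl0 (Nat.eq_zero_of_zero_dvd (hd l hl))
      · exact hpos h) (Nat.dvd_lcm_right _ _))
  exact heq ▸ Nat.dvd_lcm_left _ _

theorem ChainTransitiveOn.exists_mem_cycleLengths (hT : ChainTransitiveOn f C)
    (hne : C.Nonempty) (hδ : 0 < δ) : ∃ k ∈ cycleLengths f C δ, k ≠ 0 := by
  obtain ⟨p, hp⟩ := hne
  obtain ⟨k, hk⟩ := hT δ hδ p hp p hp
  exact ⟨k, ⟨p, hp, hk⟩, Nat.one_le_iff_ne_zero.1 hk.1⟩

theorem SimCd.mono (hT : ChainTransitiveOn f C) (hne : C.Nonempty) (hδ₁ : 0 < δ₁)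
    (hδ : δ₁ ≤ δ₂) (h : SimCd f C δ₁ x y) : SimCd f C δ₂ x y := by
  obtain ⟨k, hk, hc⟩ := h
  refine ⟨k, (dvd_setGcd (hT.exists_mem_cycleLengths hne hδ₁) ?_).trans hk, hc.mono hδ⟩
  rintro l ⟨z, hz, hl⟩
  exact setGcd_dvd (hT.exists_mem_cycleLengths hne (hδ₁.trans_le hδ)) ⟨z, hz, hl.mono hδ⟩

/-- The cyclic phase of a point of `C`: `δ`-chains of length `k` advance it by `k`, and its level
sets are the classes of `∼_{C,δ}`. -/
theorem ChainTransitiveOn.exists_phase (hT : ChainTransitiveOn f C) (hne : C.Nonempty)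
    (hδ : 0 < δ) :
    ∃ (m : ℕ) (φ : X → ZMod m),
      (∀ k x y, ChainIn f C δ k x y → φ y = φ x + k) ∧
      (∀ x ∈ C, ∀ y ∈ C, SimCd f C δ x y ↔ φ x = φ y) ∧
      (∀ x ∈ C, ∀ y ∈ C, dist x y ≤ δ / 2 → φ x = φ y) := by
  obtain ⟨p, hp⟩ := id hne
  set m := setGcd (cycleLengths f C δ) with hm
  have hcycle : ∀ k x, ChainIn f C δ k x x → (k : ZMod m) = 0 := fun k x h =>
    (ZMod.natCast_eq_zero_iff k m).2
      (setGcd_dvd (hT.exists_mem_cycleLengths hne hδ) ⟨x, h.left_mem, h⟩)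
  choose! ℓ hℓ using fun y (hy : y ∈ C) => hT δ hδ p hp y hy
  have hadd : ∀ k x y, ChainIn f C δ k x y → (ℓ y : ZMod m) = ℓ x + k := by
    intro k x y h
    obtain ⟨b, hb⟩ := hT δ hδ y h.right_mem p hp
    have h1 := hcycle _ _ (((hℓ x h.left_mem).trans h).trans hb)
    have h2 := hcycle _ _ ((hℓ y h.right_mem).trans hb)
    push_cast at h1 h2
    linear_combination h2 - h1
  refine ⟨m, fun y => (ℓ y : ZMod m), hadd, fun x hx y hy => ⟨?_, fun h => ?_⟩,
    fun x hx y hy hxy => ?_⟩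
  · rintro ⟨k, hk, hc⟩
    simp [hadd k x y hc, (ZMod.natCast_eq_zero_iff k m).2 hk]
  · obtain ⟨k, hk⟩ := hT δ hδ x hx y hy
    refine ⟨k, (ZMod.natCast_eq_zero_iff k m).1 ?_, hk⟩
    simpa [h] using hadd k x y hk
  · obtain ⟨k, hk⟩ := hT (δ / 2) (by linarith) p hp x hx
    have h1 := hadd k p x (hk.mono (by linarith))
    have h2 := hadd k p y ((hk.perturb_right hy hxy).mono (by linarith))
    exact h1.trans h2.symm

theorem ChainTransitiveOn.simCd_refl (hT : ChainTransitiveOn f C) (hδ : 0 < δ) (hx : x ∈ C) :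
    SimCd f C δ x x := by
  obtain ⟨m, φ, -, h, -⟩ := hT.exists_phase ⟨x, hx⟩ hδ
  exact (h x hx x hx).2 rfl

theorem ChainTransitiveOn.simCd_of_dist_le (hT : ChainTransitiveOn f C) (hδ : 0 < δ)
    (hx : x ∈ C) (hy : y ∈ C) (hxy : dist x y ≤ δ / 2) : SimCd f C δ x y := by
  obtain ⟨m, φ, -, h, h'⟩ := hT.exists_phase ⟨x, hx⟩ hδ
  exact (h x hx y hy).2 (h' x hx y hy hxy)

theorem ChainTransitiveOn.simClass_eq (hT : ChainTransitiveOn f C) (hδ : 0 < δ)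
    (hx : x ∈ C) (hy : y ∈ C) (hxy : SimCd f C δ x y) :
    {w ∈ C | SimCd f C δ x w} = {w ∈ C | SimCd f C δ y w} := by
  obtain ⟨m, φ, -, h, -⟩ := hT.exists_phase ⟨x, hx⟩ hδ
  ext w
  refine and_congr_right fun hw => ?_
  rw [h x hx w hw, h y hy w hw, (h x hx y hy).1 hxy]

/-- The orbit of `x` is asymptotic to the orbit of the class of `z` under `∼_{C,δ}`. -/
def AsymptoticToClass (f : X → X) (C : Set X) (δ : ℝ) (x z : X) : Prop :=
  Tendsto (fun i => infDist (f^[i] x) (f^[i] '' {y ∈ C | SimCd f C δ z y})) atTop (𝓝 0)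

theorem AsymptoticToClass.mono (hT : ChainTransitiveOn f C) (hz : z ∈ C) (hδ₁ : 0 < δ₁)
    (hδ : δ₁ ≤ δ₂) (h : AsymptoticToClass f C δ₁ x z) : AsymptoticToClass f C δ₂ x z := by
  refine squeeze_zero (fun _ => infDist_nonneg) (fun i => ?_) h
  refine infDist_le_infDist_of_subset (image_mono fun y hy => ?_)
    ⟨_, mem_image_of_mem _ ⟨hz, hT.simCd_refl hδ₁ hz⟩⟩
  exact ⟨hy.1, hy.2.mono hT ⟨z, hz⟩ hδ₁ hδ⟩

theorem AsymptoticToClass.congr (hT : ChainTransitiveOn f C) (hδ : 0 < δ)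
    (hy : y ∈ C) (hz : z ∈ C) (hyz : SimCd f C δ y z) (h : AsymptoticToClass f C δ x y) :
    AsymptoticToClass f C δ x z := by
  rwa [AsymptoticToClass, ← hT.simClass_eq hδ hy hz hyz]

theorem ChainTransitiveOn.phase_iterate (hT : ChainTransitiveOn f C) (hC : IsClosed C)
    (hδ : 0 < δ) {m : ℕ} {φ : X → ZMod m}
    (hφ : ∀ k x y, ChainIn f C δ k x y → φ y = φ x + k) (hx : x ∈ C) (i : ℕ) :
    φ (f^[i] x) = φ x + i := by
  induction i with
  | zero => simp
  | succ i ih =>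
    have hi := (hT.mapsTo hC).iterate i hx
    rw [Function.iterate_succ_apply', hφ 1 _ _
      (.single hi (hT.mapsTo hC hi) (by simpa using hδ.le)), ih]
    push_cast
    ring

theorem ChainTransitiveOn.exists_asymptoticToClass [CompactSpace X] (hf : Continuous f)
    (hT : ChainTransitiveOn f C) (hC : IsClosed C) (hne : C.Nonempty) (hδ : 0 < δ)
    (hx : x ∈ wStable f C) : ∃ z ∈ C, AsymptoticToClass f C δ x z := by
  obtain ⟨m, φ, hφ, hsim, -⟩ := hT.exists_phase hne hδ
  choose g hgC hg using hC.isCompact.exists_infDist_eq_dist hne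
  have hx0 : Tendsto (fun i => dist (f^[i] x) (g (f^[i] x))) atTop (𝓝 0) := by
    simpa only [← hg] using (show Tendsto (fun i => infDist (f^[i] x) C) atTop (𝓝 0) from hx)
  obtain ⟨η, hη, hfη⟩ := Metric.uniformContinuous_iff.1
    (CompactSpace.uniformContinuous_of_continuous hf) (δ / 2) (by linarith)
  obtain ⟨N, hN⟩ := eventually_atTop.1
    (hx0.eventually_lt_const (lt_min hη (by linarith : 0 < δ / 2)))
  have hstep : ∀ i ≥ N, φ (g (f^[i + 1] x)) = φ (g (f^[i] x)) + 1 := by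
    intro i hi
    have h1 : dist (f (f^[i] x)) (f (g (f^[i] x))) < δ / 2 :=
      hfη ((hN i hi).trans_le (min_le_left _ _))
    have h2 := (hN (i + 1) (by omega)).trans_le (min_le_right _ _)
    rw [← Function.iterate_succ_apply' f i x] at h1
    have := hφ 1 _ _ (.single (hgC (f^[i] x)) (hgC (f^[i + 1] x))
      (by linarith [dist_triangle_left (f (g (f^[i] x))) (g (f^[i + 1] x)) (f^[i + 1] x)]))
    simpa using this
  have hsurj : ∀ i, SurjOn f^[i] C C := fun i => (hT.surjOn hf hC).iterate i
  obtain ⟨z, hz, hzN⟩ := hsurj N (hgC (f^[N] x))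
  have hphase : ∀ i ≥ N, φ (g (f^[i] x)) = φ z + i := by
    intro i hi
    induction i, hi using Nat.le_induction with
    | base => rw [← hzN, hT.phase_iterate hC hδ hφ hz]
    | succ i hi ih =>
      rw [hstep i hi, ih]
      push_cast
      ring
  refine ⟨z, hz, squeeze_zero' (.of_forall fun _ => infDist_nonneg)
    (eventually_atTop.2 ⟨N, fun i hi => ?_⟩) hx0⟩
  obtain ⟨w, hw, hwi⟩ := hsurj i (hgC (f^[i] x))
  refine infDist_le_dist_of_mem ⟨w, ⟨hw, (hsim z hz w hw).2 ?_⟩, hwi⟩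
  have h1 := hphase i hi
  rw [← hwi, hT.phase_iterate hC hδ hφ hw] at h1
  exact (add_right_cancel h1).symm

theorem ChainTransitiveOn.simCd_of_frequently_infDist_lt (hT : ChainTransitiveOn f C)
    (hC : IsClosed C) (hδ : 0 < δ) (hy : y ∈ C) (hz : z ∈ C)
    (hxy : ∃ᶠ i in atTop, infDist (f^[i] x) (f^[i] '' {w ∈ C | SimCd f C δ y w}) < δ / 4)
    (hxz : AsymptoticToClass f C δ x z) : SimCd f C δ y z := by
  obtain ⟨m, φ, hφ, hsim, hdist⟩ := hT.exists_phase ⟨y, hy⟩ hδ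
  obtain ⟨i, hi1, hi2⟩ :=
    (hxy.and_eventually (hxz.eventually_lt_const (by linarith : 0 < δ / 4))).exists
  have hne : ∀ p ∈ C, (f^[i] '' {w ∈ C | SimCd f C δ p w}).Nonempty := fun p hp =>
    ⟨_, mem_image_of_mem _ ⟨hp, hT.simCd_refl hδ hp⟩⟩
  rw [infDist_lt_iff (hne y hy)] at hi1
  rw [infDist_lt_iff (hne z hz)] at hi2
  obtain ⟨_, ⟨u, ⟨hu, hyu⟩, rfl⟩, hd1⟩ := hi1
  obtain ⟨_, ⟨v, ⟨hv, hzv⟩, rfl⟩, hd2⟩ := hi2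
  have hmaps := (hT.mapsTo hC).iterate i
  have h := hdist _ (hmaps hu) _ (hmaps hv)
    (by linarith [dist_triangle_left (f^[i] u) (f^[i] v) (f^[i] x)])
  rw [hT.phase_iterate hC hδ hφ hu, hT.phase_iterate hC hδ hφ hv] at h
  rw [hsim y hy z hz, (hsim y hy u hu).1 hyu, (hsim z hz v hv).1 hzv]
  exact add_right_cancel h

theorem AsymptoticToClass.frequently_infDist_lt (hδ : 0 < δ)
    (h : AsymptoticToClass f C δ x z) :
    ∃ᶠ i in atTop, infDist (f^[i] x) (f^[i] '' {w ∈ C | SimCd f C δ z w}) < δ / 4 :=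
  (h.eventually_lt_const (by linarith)).frequently

theorem ChainTransitiveOn.mem_vStable_iff (hT : ChainTransitiveOn f C) {p : X} (hp : p ∈ C) :
    x ∈ vStable f C {y ∈ C | SimC f C p y} ↔
      x ∈ wStable f C ∧ ∀ δ > 0, AsymptoticToClass f C δ x p := by
  refine and_congr_right fun _ => forall₂_congr fun δ hδ => ⟨fun h => ?_, fun h => ?_⟩
  · exact h _ ⟨p, hp, rfl⟩ fun y hy => ⟨hy.1, hy.2 δ hδ⟩
  · rintro _ ⟨q, hq, rfl⟩ hsub
    have hqp := hsub ⟨hp, fun ε hε => hT.simCd_refl hε hp⟩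
    rw [hT.simClass_eq hδ hq hp hqp.2]
    exact h

theorem ChainTransitiveOn.exists_forall_asymptoticToClass [CompactSpace X] (hf : Continuous f)
    (hT : ChainTransitiveOn f C) (hC : IsClosed C) (hne : C.Nonempty)
    (hx : x ∈ wStable f C) : ∃ p ∈ C, ∀ δ > 0, AsymptoticToClass f C δ x p := by
  choose z hzC hz using fun n : ℕ =>
    hT.exists_asymptoticToClass hf hC hne (Nat.one_div_pos_of_nat (α := ℝ) (n := n)) hx
  obtain ⟨p, hp, ψ, hψ, hlim⟩ := hC.isCompact.tendsto_subseq hzC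
  refine ⟨p, hp, fun δ hδ => ?_⟩
  have h1 : ∀ᶠ n in atTop, dist (z (ψ n)) p < δ / 2 :=
    Metric.tendsto_nhds.1 hlim _ (by linarith)
  have h2 : ∀ᶠ n in atTop, 1 / ((ψ n : ℝ) + 1) < δ :=
    (tendsto_one_div_add_atTop_nhds_zero_nat.comp hψ.tendsto_atTop).eventually_lt_const hδ
  obtain ⟨n, hn1, hn2⟩ := (h1.and h2).exists
  exact ((hz (ψ n)).mono hT (hzC _) Nat.one_div_pos_of_nat hn2.le).congr hT hδ (hzC _) hp
    (hT.simCd_of_dist_le hδ (hzC _) hp hn1.le)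

theorem ChainTransitiveOn.simC_of_asymptoticToClass (hT : ChainTransitiveOn f C)
    (hC : IsClosed C) (hy : y ∈ C) (hz : z ∈ C)
    (hxy : ∀ δ > 0, AsymptoticToClass f C δ x y) (hxz : ∀ δ > 0, AsymptoticToClass f C δ x z) :
    SimC f C y z := fun δ hδ =>
  hT.simCd_of_frequently_infDist_lt hC hδ hy hz ((hxy δ hδ).frequently_infDist_lt hδ) (hxz δ hδ)

theorem ChainTransitiveOn.asymptoticToClass_iff_frequently [CompactSpace X] (hf : Continuous f)
    (hT : ChainTransitiveOn f C) (hC : IsClosed C) (hδ : 0 < δ) (hx : x ∈ wStable f C)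
    (hz : z ∈ C) :
    AsymptoticToClass f C δ x z ↔
      ∃ᶠ i in atTop, infDist (f^[i] x) (f^[i] '' {w ∈ C | SimCd f C δ z w}) < δ / 4 := by
  refine ⟨fun h => h.frequently_infDist_lt hδ, fun h => ?_⟩
  obtain ⟨y, hy, hxy⟩ := hT.exists_asymptoticToClass hf hC ⟨z, hz⟩ hδ hx
  refine hxy.congr hT hδ hy hz ?_
  obtain ⟨m, φ, -, hsim, -⟩ := hT.exists_phase ⟨z, hz⟩ hδ
  exact (hsim y hy z hz).2
    ((hsim z hz y hy).1 (hT.simCd_of_frequently_infDist_lt hC hδ hz hy h hxy)).symm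

theorem ChainTransitiveOn.isGδ_asymptoticToClass [CompactSpace X] (hf : Continuous f)
    (hT : ChainTransitiveOn f C) (hC : IsClosed C) (hδ : 0 < δ) (hz : z ∈ C) :
    IsGδ {q : wStable f C | AsymptoticToClass f C δ q z} := by
  have heq : {q : wStable f C | AsymptoticToClass f C δ q z} = ⋂ N : ℕ, ⋃ i ≥ N,
      {q : wStable f C | infDist (f^[i] q) (f^[i] '' {w ∈ C | SimCd f C δ z w}) < δ / 4} := by
    ext q
    rw [mem_ofPred_eq, hT.asymptoticToClass_iff_frequently hf hC hδ q.2 hz, frequently_atTop]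
    simp
  rw [heq]
  refine .iInter_of_isOpen fun N => isOpen_iUnion fun i => isOpen_iUnion fun _ => ?_
  exact isOpen_lt ((continuous_infDist_pt _).comp
    ((hf.iterate i).comp continuous_subtype_val)) continuous_const

end Chains

/-- Lemma 2.2: `W^s(C)` is the disjoint union of the sets `V^s(D)` over
`D ∈ 𝒟(C)`, and each `V^s(D)` is a `G_δ`-subset of the subspace `W^s(C)`. -/
theorem vStable_partition_and_Gdelta
    {X : Type*} [MetricSpace X] [CompactSpace X] (f : X → X) (hf : Continuous f)
    (C : Set X) (hC : IsChainComponent f C) :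
    (∀ x ∈ wStable f C, ∃! D : Set X, D ∈ DClasses f C ∧ x ∈ vStable f C D) ∧
    (∀ D ∈ DClasses f C, IsGδ {p : ↥(wStable f C) | (p : X) ∈ vStable f C D}) := by
  have hT := hC.chainTransitiveOn hf
  have hcl := hC.isClosed hf
  refine ⟨fun x hx => ?_, ?_⟩
  · obtain ⟨p, hp, hxp⟩ := hT.exists_forall_asymptoticToClass hf hcl hC.nonempty hx
    refine ⟨_, ⟨⟨p, hp, rfl⟩, (hT.mem_vStable_iff hp).2 ⟨hx, hxp⟩⟩, ?_⟩
    rintro _ ⟨⟨q, hq, rfl⟩, hxq⟩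
    have hqp := hT.simC_of_asymptoticToClass hcl hq hp ((hT.mem_vStable_iff hq).1 hxq).2 hxp
    ext w
    refine and_congr_right fun hw => forall₂_congr fun δ hδ => ?_
    have := Set.ext_iff.1 (hT.simClass_eq hδ hq hp (hqp δ hδ)) w
    simpa [hw] using this
  · rintro _ ⟨p, hp, rfl⟩
    have heq : {q : ↥(wStable f C) | (q : X) ∈ vStable f C {y ∈ C | SimC f C p y}} =
        ⋂ n : ℕ, {q : ↥(wStable f C) | AsymptoticToClass f C (1 / ((n : ℝ) + 1)) q p} := by
      ext q
      rw [mem_ofPred_eq, hT.mem_vStable_iff hp, mem_iInter]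
      refine ⟨fun h n => h.2 _ Nat.one_div_pos_of_nat, fun h => ⟨q.2, fun δ hδ => ?_⟩⟩
      obtain ⟨n, hn⟩ := exists_nat_one_div_lt hδ
      exact (h n).mono hT hp Nat.one_div_pos_of_nat hn.le
    rw [heq]
    exact .iInter fun n => hT.isGδ_asymptoticToClass hf hcl Nat.one_div_pos_of_nat hp
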